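/- Suppose the prior density π_τ vanishes on (0,T) for some T > 0. Fix δ₀, δ₁ ∈ (0,1) and let V(x) = Σ_{j=1}^p x_j^{δ₀/2} + Σ_{j=1}^p x_j^{−δ₁/2}. Then for every d > 0 there exist ε* > 0 and a probability density h on (0,∞)^p such that k(x, x′) ≥ ε* h(x′) for every x′ ∈ (0,∞)^p and every x ∈ (0,∞)^p with V(x) ≤ d. -/

import Mathlib

open Matrix MeasureTheory

/-- The Inverse-Gamma(α, β) density `u ↦ β^α Γ(α)⁻¹ u^{−α−1} e^{−β/u}`. -/
noncomputable def igDens (α β u : ℝ) : ℝ :=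
  β ^ α * (Real.Gamma α)⁻¹ * u ^ (-α - 1) * Real.exp (-β / u)

/-- `A(t, x) = XᵀX + (t Λ_x)⁻¹` with `Λ_x = diag(x₁, …, x_p)`. -/
noncomputable def hsA (n p : ℕ) (X : Matrix (Fin n) (Fin p) ℝ)
    (t : ℝ) (x : Fin p → ℝ) : Matrix (Fin p) (Fin p) ℝ :=
  X.transpose * X + (t • Matrix.diagonal x)⁻¹

/-- `r(t, x) = yᵀ(I − X A(t,x)⁻¹ Xᵀ)y/2 + b`. -/
noncomputable def hsR (n p : ℕ) (X : Matrix (Fin n) (Fin p) ℝ)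
    (y : Fin n → ℝ) (b t : ℝ) (x : Fin p → ℝ) : ℝ :=
  y ⬝ᵥ ((1 - X * (hsA n p X t x)⁻¹ * X.transpose).mulVec y) / 2 + b

/-- The `N_p(μ, s A⁻¹)` density at `β`:
`(2π s)^{−p/2} det(A)^{1/2} exp(−(β−μ)ᵀA(β−μ)/(2s))`. -/
noncomputable def gaussDens (p : ℕ) (A : Matrix (Fin p) (Fin p) ℝ)
    (μ : Fin p → ℝ) (s : ℝ) (β : Fin p → ℝ) : ℝ :=
  (2 * Real.pi * s) ^ (-(p : ℝ) / 2) * A.det ^ ((1 : ℝ) / 2) *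
    Real.exp (-((β - μ) ⬝ᵥ A.mulVec (β - μ)) / (2 * s))

/-- The unnormalized conditional posterior density of `τ² = t` given the
squared local shrinkage parameters `x`:
`f_x(t) = r(t,x)^{−(a+n/2)} det(I + t XᵀX Λ_x)^{−1/2} π_τ(t)`. -/
noncomputable def hsTauDens (n p : ℕ) (X : Matrix (Fin n) (Fin p) ℝ)
    (y : Fin n → ℝ) (a b : ℝ) (πτ : ℝ → ℝ) (x : Fin p → ℝ) (t : ℝ) : ℝ :=
  hsR n p X y b t x ^ (-(a + (n : ℝ) / 2)) *
    ((1 + t • (X.transpose * X * Matrix.diagonal x)).det) ^ (-(1 / 2 : ℝ)) *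
    πτ t

/-- The Markov transition density of the marginal λ-chain of the two-block
Horseshoe Gibbs sampler, as an iterated integral over `t ∈ (0,∞)`,
`ν ∈ (0,∞)^p`, `σ² = s ∈ (0,∞)`, `β ∈ ℝ^p`. -/
noncomputable def hsMTD (n p : ℕ) (X : Matrix (Fin n) (Fin p) ℝ)
    (y : Fin n → ℝ) (a b : ℝ) (πτ : ℝ → ℝ) (x x' : Fin p → ℝ) : ℝ :=
  ∫ t in Set.Ioi (0 : ℝ),
    (∫ ν in Set.univ.pi (fun _ : Fin p => Set.Ioi (0 : ℝ)),
      (∫ s in Set.Ioi (0 : ℝ),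
        (∫ β : Fin p → ℝ,
          (∏ j, igDens 1 ((ν j)⁻¹ + (β j) ^ 2 / (2 * s * t)) (x' j)) *
            gaussDens p (hsA n p X t x)
              ((hsA n p X t x)⁻¹.mulVec (X.transpose.mulVec y)) s β) *
          igDens (a + (n : ℝ) / 2) (hsR n p X y b t x) s) *
        ∏ j, igDens 1 (1 + (x j)⁻¹) (ν j)) *
    (hsTauDens n p X y a b πτ x t /
      ∫ u in Set.Ioi (0 : ℝ), hsTauDens n p X y a b πτ x u)

/-! ### Inverse-Gamma densities -/

theorem igDens_nonneg {α β u : ℝ} (hα : 0 < α) (hβ : 0 ≤ β) (hu : 0 < u) : 0 ≤ igDens α β u := by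
  unfold igDens
  have := Real.Gamma_pos_of_pos hα
  positivity

theorem igDens_one {β u : ℝ} (hu : 0 < u) : igDens 1 β u = β * (u ^ 2)⁻¹ * Real.exp (-β / u) := by
  unfold igDens
  rw [Real.rpow_one, Real.Gamma_one, show (-1 - 1 : ℝ) = -((2 : ℕ) : ℝ) by norm_num,
    Real.rpow_neg hu.le, Real.rpow_natCast]
  ring

theorem igDens_one_le {β u : ℝ} (hu : 0 < u) : igDens 1 β u ≤ u⁻¹ := by
  rw [igDens_one hu]
  have h1 : β / u * Real.exp (-(β / u)) ≤ 1 := by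
    have := Real.add_one_le_exp (β / u)
    rw [Real.exp_neg, ← div_eq_mul_inv, div_le_one (Real.exp_pos _)]
    linarith
  have h2 : β * (u ^ 2)⁻¹ * Real.exp (-β / u) = u⁻¹ * (β / u * Real.exp (-(β / u))) := by
    rw [neg_div]; field_simp
  rw [h2]
  exact mul_le_of_le_one_right (by positivity) h1

theorem igDens_integral {α β : ℝ} (hα : 0 < α) (hβ : 0 < β) :
    ∫ u in Set.Ioi (0 : ℝ), igDens α β u = 1 := by
  have hG := Real.Gamma_pos_of_pos hα
  have h := integral_comp_rpow_Ioi (fun u : ℝ => β ^ α * (Real.Gamma α)⁻¹ *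
    (u ^ (α - 1) * Real.exp (-(β * u)))) (p := -1) (by norm_num)
  rw [integral_const_mul, Real.integral_rpow_mul_exp_neg_mul_Ioi hα hβ] at h
  have h3 : β ^ α * (Real.Gamma α)⁻¹ * ((1 / β) ^ α * Real.Gamma α) = 1 := by
    rw [one_div, Real.inv_rpow hβ.le]
    have : β ^ α ≠ 0 := by positivity
    field_simp
  rw [h3] at h
  rw [← h]
  refine setIntegral_congr_fun measurableSet_Ioi fun u hu => ?_
  have hu : 0 < u := hu
  have e1 : u ^ (-α - 1) = u ^ (-1 - 1 : ℝ) * (u ^ (-1 : ℝ)) ^ (α - 1) := by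
    rw [← Real.rpow_mul hu.le, ← Real.rpow_add hu]; congr 1; ring
  simp only [igDens, smul_eq_mul, e1, abs_neg, abs_one, one_mul]
  rw [show -β / u = -(β * u ^ (-1 : ℝ)) by rw [Real.rpow_neg_one]; field_simp]
  ring

theorem igDens_integrable {α β : ℝ} (hα : 0 < α) (hβ : 0 < β) :
    IntegrableOn (igDens α β) (Set.Ioi (0 : ℝ)) :=
  integrable_of_integral_eq_one (igDens_integral hα hβ)

theorem volume_restrict_pi (p : ℕ) (S : Set ℝ) :
    (volume : Measure (Fin p → ℝ)).restrict (Set.univ.pi (fun _ : Fin p => S)) =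
      Measure.pi (fun _ : Fin p => (volume : Measure ℝ).restrict S) := by
  rw [volume_pi, Measure.restrict_pi_pi]

theorem prod_igDens_integral {p : ℕ} {β : Fin p → ℝ} (hβ : ∀ j, 0 < β j) :
    ∫ ν in Set.univ.pi (fun _ : Fin p => Set.Ioi (0 : ℝ)), ∏ j, igDens 1 (β j) (ν j) = 1 := by
  rw [volume_restrict_pi, integral_fintype_prod_eq_prod (fun j => igDens 1 (β j))]
  exact Finset.prod_eq_one fun j _ => igDens_integral one_pos (hβ j)

theorem prod_igDens_integrable {p : ℕ} {β : Fin p → ℝ} (hβ : ∀ j, 0 < β j) :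
    IntegrableOn (fun ν : Fin p → ℝ => ∏ j, igDens 1 (β j) (ν j))
      (Set.univ.pi (fun _ : Fin p => Set.Ioi (0 : ℝ))) :=
  integrable_of_integral_eq_one (prod_igDens_integral hβ)

/-! ### Linear algebra -/

theorem hsA_eq {n p : ℕ} (X : Matrix (Fin n) (Fin p) ℝ) {t : ℝ} {x : Fin p → ℝ}
    (ht : 0 < t) (hx : ∀ j, 0 < x j) :
    hsA n p X t x = Xᵀ * X + diagonal (fun j => (t * x j)⁻¹) := by
  unfold hsA
  congr 1
  apply Matrix.inv_eq_left_inv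
  rw [← diagonal_smul, diagonal_mul_diagonal, ← diagonal_one]
  congr 1
  ext j
  have := hx j
  simp only [Pi.smul_apply, smul_eq_mul]
  field_simp

theorem hsA_posDef {n p : ℕ} (X : Matrix (Fin n) (Fin p) ℝ) {t : ℝ} {x : Fin p → ℝ}
    (ht : 0 < t) (hx : ∀ j, 0 < x j) : (hsA n p X t x).PosDef := by
  rw [hsA_eq X ht hx]
  apply PosDef.posSemidef_add
  · have := posSemidef_conjTranspose_mul_self X
    rwa [conjTranspose_eq_transpose_of_trivial] at this
  · exact PosDef.diagonal fun j => inv_pos.2 (mul_pos ht (hx j))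

theorem hsA_quad {n p : ℕ} (X : Matrix (Fin n) (Fin p) ℝ) {t : ℝ} {x : Fin p → ℝ}
    (ht : 0 < t) (hx : ∀ j, 0 < x j) (v : Fin p → ℝ) :
    v ⬝ᵥ (hsA n p X t x *ᵥ v) = (X *ᵥ v) ⬝ᵥ (X *ᵥ v) + ∑ j, v j ^ 2 * (t * x j)⁻¹ := by
  rw [hsA_eq X ht hx, add_mulVec, dotProduct_add]
  congr 1
  · rw [← mulVec_mulVec, dotProduct_mulVec, vecMul_transpose]
  · simp only [dotProduct, mulVec_diagonal]
    exact Finset.sum_congr rfl fun j _ => by ring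

/-- Completing the square. -/
theorem hsA_square {n p : ℕ} (X : Matrix (Fin n) (Fin p) ℝ) (y : Fin n → ℝ) (b : ℝ)
    {t : ℝ} {x : Fin p → ℝ} (ht : 0 < t) (hx : ∀ j, 0 < x j) (β : Fin p → ℝ) :
    (β - (hsA n p X t x)⁻¹ *ᵥ (Xᵀ *ᵥ y)) ⬝ᵥ
        (hsA n p X t x *ᵥ (β - (hsA n p X t x)⁻¹ *ᵥ (Xᵀ *ᵥ y))) =
      (X *ᵥ β - y) ⬝ᵥ (X *ᵥ β - y) + ∑ j, β j ^ 2 * (t * x j)⁻¹ - 2 * (hsR n p X y b t x - b) := by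
  have hP := hsA_posDef X ht hx
  have hq := hsA_quad X ht hx β
  have hr : hsR n p X y b t x =
    y ⬝ᵥ ((1 - X * (hsA n p X t x)⁻¹ * Xᵀ) *ᵥ y) / 2 + b := rfl
  rw [hr]
  set A := hsA n p X t x with hA
  have hu : IsUnit A.det := hP.det_pos.ne'.isUnit
  have hAt : Aᵀ = A := by
    have := hP.isHermitian
    rwa [IsHermitian, conjTranspose_eq_transpose_of_trivial] at this
  set μ := A⁻¹ *ᵥ (Xᵀ *ᵥ y) with hμ
  have hAμ : A *ᵥ μ = Xᵀ *ᵥ y := by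
    rw [hμ, mulVec_mulVec, mul_nonsing_inv A hu, one_mulVec]
  have h1 : μ ⬝ᵥ (A *ᵥ β) = β ⬝ᵥ (Xᵀ *ᵥ y) := by
    rw [dotProduct_mulVec, ← mulVec_transpose, hAt, hAμ, dotProduct_comm]
  have h2 : β ⬝ᵥ (Xᵀ *ᵥ y) = (X *ᵥ β) ⬝ᵥ y := by
    rw [dotProduct_mulVec, vecMul_transpose]
  have h3 : μ ⬝ᵥ (Xᵀ *ᵥ y) = y ⬝ᵥ (X *ᵥ μ) := by
    rw [dotProduct_mulVec, vecMul_transpose, dotProduct_comm]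
  have h4 : (X * A⁻¹ * Xᵀ) *ᵥ y = X *ᵥ μ := by
    rw [hμ, mulVec_mulVec, mulVec_mulVec, Matrix.mul_assoc]
  rw [mulVec_sub, hAμ, sub_dotProduct, dotProduct_sub, dotProduct_sub, h1, hq, h2, h3,
    sub_mulVec, h4, one_mulVec, dotProduct_sub, dotProduct_sub, sub_dotProduct, sub_dotProduct,
   
    dotProduct_comm y (X *ᵥ β)]
  ring

theorem dotProduct_self_nonneg' {m : ℕ} (v : Fin m → ℝ) : 0 ≤ v ⬝ᵥ v :=
  Finset.sum_nonneg fun i _ => mul_self_nonneg (v i)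

theorem hsR_le {n p : ℕ} (X : Matrix (Fin n) (Fin p) ℝ) (y : Fin n → ℝ) (b : ℝ)
    {t : ℝ} {x : Fin p → ℝ} (ht : 0 < t) (hx : ∀ j, 0 < x j) :
    hsR n p X y b t x ≤ b + y ⬝ᵥ y / 2 := by
  have h := hsA_square X y b ht hx 0
  have h2 := (hsA_posDef X ht hx).posSemidef.dotProduct_mulVec_nonneg
    (0 - (hsA n p X t x)⁻¹ *ᵥ (Xᵀ *ᵥ y))
  rw [star_trivial, h] at h2
  simp at h2
  linarith

theorem hsR_ge {n p : ℕ} (X : Matrix (Fin n) (Fin p) ℝ) (y : Fin n → ℝ) (b : ℝ)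
    {t : ℝ} {x : Fin p → ℝ} (ht : 0 < t) (hx : ∀ j, 0 < x j) :
    b ≤ hsR n p X y b t x := by
  have h := hsA_square X y b ht hx ((hsA n p X t x)⁻¹ *ᵥ (Xᵀ *ᵥ y))
  rw [sub_self, zero_dotProduct] at h
  have h1 := dotProduct_self_nonneg' (X *ᵥ ((hsA n p X t x)⁻¹ *ᵥ (Xᵀ *ᵥ y)) - y)
  have h2 : 0 ≤ ∑ j, ((hsA n p X t x)⁻¹ *ᵥ (Xᵀ *ᵥ y)) j ^ 2 * (t * x j)⁻¹ :=
    Finset.sum_nonneg fun j _ => by have := hx j; positivity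
  linarith

/-- `D(t,x) = det (I + t XᵀX Λ)`. -/
noncomputable def hsD (n p : ℕ) (X : Matrix (Fin n) (Fin p) ℝ) (t : ℝ) (x : Fin p → ℝ) : ℝ :=
  (1 + t • (X.transpose * X * Matrix.diagonal x)).det

theorem hsD_eq {n p : ℕ} (X : Matrix (Fin n) (Fin p) ℝ) {t : ℝ} {x : Fin p → ℝ}
    (ht : 0 < t) (hx : ∀ j, 0 < x j) :
    hsD n p X t x = (hsA n p X t x).det * ∏ j, (t * x j) := by
  rw [← det_diagonal, ← det_mul, hsA_eq X ht hx, add_mul, diagonal_mul_diagonal, hsD, add_comm]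
  congr 2
  · rw [← Matrix.mul_smul, ← diagonal_smul]; rfl
  · rw [← diagonal_one]
    congr 1
    ext j
    have := hx j
    field_simp

theorem hsD_ge_one {n p : ℕ} (X : Matrix (Fin n) (Fin p) ℝ) {t : ℝ} {x : Fin p → ℝ}
    (ht : 0 < t) (hx : ∀ j, 0 < x j) : 1 ≤ hsD n p X t x := by
  have h1 : hsD n p X t x = (1 + X * (diagonal (fun j => t * x j)) * Xᵀ).det := by
    rw [Matrix.mul_assoc, det_one_add_mul_comm, Matrix.mul_assoc, det_one_add_mul_comm, hsD,
      ← Matrix.mul_smul, ← diagonal_smul]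
    rfl
  have hPS : (X * (diagonal (fun j => t * x j)) * Xᵀ).PosSemidef := by
    have := (PosSemidef.diagonal (R := ℝ) (d := fun j => t * x j)
      (fun j => (mul_pos ht (hx j)).le)).mul_mul_conjTranspose_same X
    rwa [conjTranspose_eq_transpose_of_trivial] at this
  set P := X * (diagonal (fun j => t * x j)) * Xᵀ
  have hH : (1 + P).IsHermitian := isHermitian_one.add hPS.isHermitian
  rw [h1, hH.det_eq_prod_eigenvalues]
  refine Finset.prod_induction _ (fun z : ℝ => 1 ≤ z)
    (fun _ _ h h' => one_le_mul_of_one_le_of_one_le h h') le_rfl fun i _ => ?_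
  simp only [RCLike.ofReal_real_eq_id, id]
  rw [hH.eigenvalues_eq i, add_mulVec, dotProduct_add, one_mulVec]
  have e1 : star (hH.eigenvectorBasis i).ofLp ⬝ᵥ (hH.eigenvectorBasis i).ofLp = 1 := by
    have h := hH.eigenvectorBasis.orthonormal.1 i
    have h2 := real_inner_self_eq_norm_sq (hH.eigenvectorBasis i)
    rw [h, EuclideanSpace.inner_eq_star_dotProduct] at h2
    rw [dotProduct_comm]
    simpa using h2
  have e2 := hPS.dotProduct_mulVec_nonneg (hH.eigenvectorBasis i).ofLp
  rw [e1]
  simp only [RCLike.re_to_real]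
  linarith

/-! ### Gaussian bounds -/

theorem gaussDens_nonneg {p : ℕ} {A : Matrix (Fin p) (Fin p) ℝ} (hA : A.PosDef) (μ : Fin p → ℝ)
    {s : ℝ} (hs : 0 < s) (β : Fin p → ℝ) : 0 ≤ gaussDens p A μ s β := by
  unfold gaussDens
  have := hA.det_pos
  positivity

theorem gaussDens_le {n p : ℕ} (X : Matrix (Fin n) (Fin p) ℝ) {t : ℝ} {x : Fin p → ℝ}
    (ht : 0 < t) (hx : ∀ j, 0 < x j) (μ : Fin p → ℝ) {s : ℝ} (hs : 0 < s) (β : Fin p → ℝ) :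
    gaussDens p (hsA n p X t x) μ s β ≤
      (2 * Real.pi * s) ^ (-(p : ℝ) / 2) * (hsA n p X t x).det ^ ((1 : ℝ) / 2) *
        ∏ j, Real.exp (-(2 * s * (t * x j))⁻¹ * (β j - μ j) ^ 2) := by
  unfold gaussDens
  have := (hsA_posDef X ht hx).det_pos
  refine mul_le_mul_of_nonneg_left ?_ (by positivity)
  rw [← Real.exp_sum, Real.exp_le_exp, hsA_quad X ht hx]
  have h1 := dotProduct_self_nonneg' (X *ᵥ (β - μ))
  have h2 : ∑ j, -(2 * s * (t * x j))⁻¹ * (β j - μ j) ^ 2 =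
      -(∑ j, (β - μ) j ^ 2 * (t * x j)⁻¹) / (2 * s) := by
    rw [← Finset.sum_neg_distrib, Finset.sum_div]
    refine Finset.sum_congr rfl fun j _ => ?_
    have := hx j
    simp only [Pi.sub_apply]
    field_simp
  rw [h2]
  gcongr
  linarith

theorem gauss_bound_integrable {p : ℕ} (c μ : Fin p → ℝ) (hc : ∀ j, 0 < c j) :
    Integrable (fun β : Fin p → ℝ => ∏ j, Real.exp (-(c j) * (β j - μ j) ^ 2)) := by
  rw [volume_pi]
  exact Integrable.fintype_prod (f := fun j (v : ℝ) => Real.exp (-(c j) * (v - μ j) ^ 2))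
    fun j => (integrable_exp_neg_mul_sq (hc j)).comp_sub_right (μ j)

theorem gauss_bound_integral {p : ℕ} (c μ : Fin p → ℝ) :
    ∫ β : Fin p → ℝ, ∏ j, Real.exp (-(c j) * (β j - μ j) ^ 2) = ∏ j, √(Real.pi / c j) := by
  rw [volume_pi, integral_fintype_prod_eq_prod (fun j (v : ℝ) => Real.exp (-(c j) * (v - μ j) ^ 2))]
  refine Finset.prod_congr rfl fun j _ => ?_
  rw [integral_sub_right_eq_self (fun v : ℝ => Real.exp (-(c j) * v ^ 2)), integral_gaussian]

theorem gauss_const {n p : ℕ} (X : Matrix (Fin n) (Fin p) ℝ) {t : ℝ} {x : Fin p → ℝ}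
    (ht : 0 < t) (hx : ∀ j, 0 < x j) {s : ℝ} (hs : 0 < s) :
    (2 * Real.pi * s) ^ (-(p : ℝ) / 2) * (hsA n p X t x).det ^ ((1 : ℝ) / 2) *
        ∏ j, √(Real.pi / (2 * s * (t * x j))⁻¹) = hsD n p X t x ^ ((1 : ℝ) / 2) := by
  have hd := (hsA_posDef X ht hx).det_pos
  have hpi := Real.pi_pos
  have h1 : ∀ j, √(Real.pi / (2 * s * (t * x j))⁻¹) =
      (2 * Real.pi * s) ^ ((1 : ℝ) / 2) * (t * x j) ^ ((1 : ℝ) / 2) := by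
    intro j
    have := hx j
    rw [← Real.mul_rpow (by positivity) (by positivity), Real.sqrt_eq_rpow]
    congr 1
    field_simp
  simp only [h1]
  rw [Finset.prod_mul_distrib, Finset.prod_const, Finset.card_univ, Fintype.card_fin,
    Real.finsetProd_rpow _ _ (fun j _ => (mul_pos ht (hx j)).le), hsD_eq X ht hx,
    Real.mul_rpow hd.le (Finset.prod_nonneg fun j _ => (mul_pos ht (hx j)).le),
    ← Real.rpow_natCast, ← Real.rpow_mul (by positivity)]
  have h2 : (2 * Real.pi * s) ^ (-(p : ℝ) / 2) * (2 * Real.pi * s) ^ (1 / 2 * (p : ℝ)) = 1 := by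
    rw [← Real.rpow_add (by positivity), show -(p : ℝ) / 2 + 1 / 2 * p = 0 by ring, Real.rpow_zero]
  linear_combination (hsA n p X t x).det ^ ((1 : ℝ) / 2) * (∏ i, t * x i) ^ ((1 : ℝ) / 2) * h2

/-- lower bound of the Gaussian density -/
theorem gaussDens_ge {n p : ℕ} (X : Matrix (Fin n) (Fin p) ℝ) (y : Fin n → ℝ)
    {t T T2 m M Q : ℝ} {x : Fin p → ℝ} (hT : 0 < T) (ht : T ≤ t) (ht2 : t ≤ T2)
    (hm : 0 < m) (hx : ∀ j, m ≤ x j) (hxM : ∀ j, x j ≤ M)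
    {s : ℝ} (hs : 1 ≤ s) (hs2 : s ≤ 2) (β : Fin p → ℝ) (hβ : ∀ j, β j ^ 2 ≤ 1)
    (hQ : (X *ᵥ β - y) ⬝ᵥ (X *ᵥ β - y) ≤ Q) :
    (2 * Real.pi * 2) ^ (-(p : ℝ) / 2) * ((T2 * M) ^ p) ^ (-((1 : ℝ) / 2)) *
      Real.exp (-(Q + p * (T * m)⁻¹)) * hsD n p X t x ^ ((1 : ℝ) / 2) ≤
    gaussDens p (hsA n p X t x) ((hsA n p X t x)⁻¹ *ᵥ (Xᵀ *ᵥ y)) s β := by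
  have ht0 : 0 < t := hT.trans_le ht
  have hx0 : ∀ j, 0 < x j := fun j => hm.trans_le (hx j)
  have hpi := Real.pi_pos
  have hd := (hsA_posDef X ht0 hx0).det_pos
  unfold gaussDens
  rw [hsA_square X y 0 ht0 hx0]
  have hr := hsR_ge X y 0 ht0 hx0
  have hprod : 0 < ∏ j, (t * x j) := Finset.prod_pos fun j _ => mul_pos ht0 (hx0 j)
  have e1 : (2 * Real.pi * 2) ^ (-(p : ℝ) / 2) ≤ (2 * Real.pi * s) ^ (-(p : ℝ) / 2) := by
    apply Real.rpow_le_rpow_of_nonpos (by positivity) (by gcongr)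
    have : (0 : ℝ) ≤ p := by positivity
    linarith
  have hpr : ∏ j, (t * x j) ≤ (T2 * M) ^ p := by
    calc ∏ j, (t * x j) ≤ ∏ _j : Fin p, (T2 * M) :=
          Finset.prod_le_prod (fun j _ => (mul_pos ht0 (hx0 j)).le)
            fun j _ => mul_le_mul ht2 (hxM j) (hx0 j).le (ht0.le.trans ht2)
      _ = _ := by simp
  have e2 : ((T2 * M) ^ p) ^ (-((1 : ℝ) / 2)) * hsD n p X t x ^ ((1 : ℝ) / 2) ≤
      (hsA n p X t x).det ^ ((1 : ℝ) / 2) := by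
    rw [hsD_eq X ht0 hx0, Real.mul_rpow hd.le hprod.le]
    have : ((T2 * M) ^ p) ^ (-((1 : ℝ) / 2)) ≤ (∏ j, (t * x j)) ^ (-((1 : ℝ) / 2)) :=
      Real.rpow_le_rpow_of_nonpos hprod hpr (by norm_num)
    have h3 : (∏ j, (t * x j)) ^ (-((1 : ℝ) / 2)) * (∏ j, (t * x j)) ^ ((1 : ℝ) / 2) = 1 := by
      rw [← Real.rpow_add hprod, neg_add_cancel, Real.rpow_zero]
    calc _ ≤ (∏ j, (t * x j)) ^ (-((1 : ℝ) / 2)) *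
          ((hsA n p X t x).det ^ ((1 : ℝ) / 2) * (∏ j, (t * x j)) ^ ((1 : ℝ) / 2)) :=
          mul_le_mul_of_nonneg_right this (by positivity)
      _ = _ := by linear_combination (hsA n p X t x).det ^ ((1 : ℝ) / 2) * h3
  have hsum : ∑ j, β j ^ 2 * (t * x j)⁻¹ ≤ p * (T * m)⁻¹ := by
    calc ∑ j, β j ^ 2 * (t * x j)⁻¹ ≤ ∑ _j : Fin p, (T * m)⁻¹ := by
          refine Finset.sum_le_sum fun j _ => ?_
          have h4 : (t * x j)⁻¹ ≤ (T * m)⁻¹ :=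
            inv_anti₀ (by positivity) (mul_le_mul ht (hx j) hm.le ht0.le)
          have h5 : 0 < (t * x j)⁻¹ := inv_pos.2 (mul_pos ht0 (hx0 j))
          nlinarith [hβ j, sq_nonneg (β j)]
      _ = _ := by simp
  have hsum0 : 0 ≤ ∑ j, β j ^ 2 * (t * x j)⁻¹ :=
    Finset.sum_nonneg fun j _ => by have := hx0 j; positivity
  have hq0 := dotProduct_self_nonneg' (X *ᵥ β - y)
  have e3 : Real.exp (-(Q + p * (T * m)⁻¹)) ≤ Real.exp (-((X *ᵥ β - y) ⬝ᵥ (X *ᵥ β - y) +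
      ∑ j, β j ^ 2 * (t * x j)⁻¹ - 2 * (hsR n p X y 0 t x - 0)) / (2 * s)) := by
    rw [Real.exp_le_exp, neg_div, neg_le_neg_iff, div_le_iff₀ (by linarith)]
    nlinarith
  have hD : 0 < hsD n p X t x := zero_lt_one.trans_le (hsD_ge_one X ht0 hx0)
  have hMp : 0 < (T2 * M) ^ p := hprod.trans_le hpr
  calc _ = (2 * Real.pi * 2) ^ (-(p : ℝ) / 2) * (((T2 * M) ^ p) ^ (-((1 : ℝ) / 2)) *
        hsD n p X t x ^ ((1 : ℝ) / 2)) * Real.exp (-(Q + p * (T * m)⁻¹)) := by ring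
    _ ≤ _ := by gcongr

/-! ### Measurability -/

theorem meas_det {Ω : Type*} [MeasurableSpace Ω] {p : ℕ} {M : Ω → Matrix (Fin p) (Fin p) ℝ}
    (h : ∀ i j, Measurable fun w => M w i j) : Measurable fun w => (M w).det := by
  simp only [det_apply]
  exact Finset.measurable_sum _ fun σ _ =>
    (Finset.measurable_prod _ fun i _ => h _ _).const_smul _

theorem meas_inv {Ω : Type*} [MeasurableSpace Ω] {p : ℕ} {M : Ω → Matrix (Fin p) (Fin p) ℝ}
    (h : ∀ i j, Measurable fun w => M w i j) (i j : Fin p) : Measurable fun w => (M w)⁻¹ i j := by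
  simp only [inv_def, Matrix.smul_apply, smul_eq_mul, Ring.inverse_eq_inv', adjugate_apply]
  refine (meas_det h).inv.mul (meas_det fun k l => ?_)
  by_cases hk : k = j
  · subst hk; simp only [updateRow_self]; exact measurable_const
  · simp only [updateRow_ne hk]; exact h k l

theorem meas_mul {Ω : Type*} [MeasurableSpace Ω] {k l m : ℕ} {M : Ω → Matrix (Fin k) (Fin l) ℝ}
    {N : Ω → Matrix (Fin l) (Fin m) ℝ}
    (h : ∀ i j, Measurable fun w => M w i j) (h' : ∀ i j, Measurable fun w => N w i j)
    (i : Fin k) (j : Fin m) : Measurable fun w => (M w * N w) i j := by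
  simp only [mul_apply]
  exact Finset.measurable_sum _ fun q _ => (h _ _).mul (h' _ _)

theorem meas_mulVec {Ω : Type*} [MeasurableSpace Ω] {k l : ℕ} {M : Ω → Matrix (Fin k) (Fin l) ℝ}
    {v : Ω → Fin l → ℝ}
    (h : ∀ i j, Measurable fun w => M w i j) (h' : ∀ i, Measurable fun w => v w i)
    (i : Fin k) : Measurable fun w => (M w *ᵥ v w) i := by
  simp only [mulVec, dotProduct]
  exact Finset.measurable_sum _ fun q _ => (h _ _).mul (h' _)

theorem meas_dot {Ω : Type*} [MeasurableSpace Ω] {k : ℕ} {u v : Ω → Fin k → ℝ}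
    (h : ∀ i, Measurable fun w => u w i) (h' : ∀ i, Measurable fun w => v w i) :
    Measurable fun w => u w ⬝ᵥ v w := by
  simp only [dotProduct]
  exact Finset.measurable_sum _ fun q _ => (h _).mul (h' _)

theorem meas_hsA {n p : ℕ} (X : Matrix (Fin n) (Fin p) ℝ) (x : Fin p → ℝ) (i j : Fin p) :
    Measurable fun t => hsA n p X t x i j := by
  simp only [hsA, Matrix.add_apply]
  refine measurable_const.add (meas_inv (fun k l => ?_) i j)
  simp only [Matrix.smul_apply, smul_eq_mul]
  fun_prop

theorem meas_hsR {n p : ℕ} (X : Matrix (Fin n) (Fin p) ℝ) (y : Fin n → ℝ) (b : ℝ)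
    (x : Fin p → ℝ) : Measurable fun t => hsR n p X y b t x := by
  unfold hsR
  refine ((meas_dot (u := fun _ => y) (fun _ => measurable_const)
    (meas_mulVec (v := fun _ => y) (fun i j => ?_)
    (fun _ => measurable_const))).div_const 2).add_const b
  simp only [Matrix.sub_apply]
  exact measurable_const.sub (meas_mul (N := fun _ => Xᵀ)
    (meas_mul (M := fun _ => X) (fun _ _ => measurable_const)
    (meas_inv (meas_hsA X x))) (fun _ _ => measurable_const) i j)

theorem meas_hsD {n p : ℕ} (X : Matrix (Fin n) (Fin p) ℝ)
    (x : Fin p → ℝ) : Measurable fun t => hsD n p X t x := by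
  unfold hsD
  refine meas_det fun i j => ?_
  simp only [Matrix.add_apply, Matrix.smul_apply, smul_eq_mul]
  fun_prop

theorem meas_mu {n p : ℕ} (X : Matrix (Fin n) (Fin p) ℝ) (y : Fin n → ℝ) (x : Fin p → ℝ)
    (i : Fin p) : Measurable fun t => ((hsA n p X t x)⁻¹ *ᵥ (Xᵀ *ᵥ y)) i :=
  meas_mulVec (v := fun _ => Xᵀ *ᵥ y) (meas_inv (meas_hsA X x)) (fun _ => measurable_const) i

theorem meas_ig {Ω : Type*} [MeasurableSpace Ω] {α : ℝ} {f g : Ω → ℝ} (hf : Measurable f)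
    (hg : Measurable g) : Measurable fun w => igDens α (f w) (g w) := by
  unfold igDens
  fun_prop

theorem meas_gauss {n p : ℕ} (X : Matrix (Fin n) (Fin p) ℝ) (y : Fin n → ℝ) (x : Fin p → ℝ) :
    Measurable fun q : (ℝ × ℝ) × (Fin p → ℝ) => gaussDens p (hsA n p X q.1.1 x)
      ((hsA n p X q.1.1 x)⁻¹ *ᵥ (Xᵀ *ᵥ y)) q.1.2 q.2 := by
  unfold gaussDens
  have h1 : Measurable fun q : (ℝ × ℝ) × (Fin p → ℝ) => (hsA n p X q.1.1 x).det :=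
    (meas_det (meas_hsA X x)).comp (measurable_fst.comp measurable_fst)
  have h2 : ∀ i, Measurable fun q : (ℝ × ℝ) × (Fin p → ℝ) =>
      (q.2 - (hsA n p X q.1.1 x)⁻¹ *ᵥ (Xᵀ *ᵥ y)) i := fun i => by
    have : Measurable fun q : (ℝ × ℝ) × (Fin p → ℝ) =>
        ((hsA n p X q.1.1 x)⁻¹ *ᵥ (Xᵀ *ᵥ y)) i :=
      (meas_mu X y x i).comp (measurable_fst.comp measurable_fst)
    simp only [Pi.sub_apply]
    exact ((measurable_pi_apply i).comp measurable_snd).sub this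
  have h3 : Measurable fun q : (ℝ × ℝ) × (Fin p → ℝ) =>
      (q.2 - (hsA n p X q.1.1 x)⁻¹ *ᵥ (Xᵀ *ᵥ y)) ⬝ᵥ
        (hsA n p X q.1.1 x *ᵥ (q.2 - (hsA n p X q.1.1 x)⁻¹ *ᵥ (Xᵀ *ᵥ y))) :=
    meas_dot h2 (meas_mulVec (fun i j => (meas_hsA X x i j).comp
      (measurable_fst.comp measurable_fst)) h2)
  fun_prop

/-! ### Integration levels -/

theorem box_lower {Ω : Type*} [MeasurableSpace Ω] {μ : Measure Ω} {S B : Set Ω} {f : Ω → ℝ} {c : ℝ}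
    (hS : MeasurableSet S) (hB : MeasurableSet B) (hBS : B ⊆ S) (hμ : μ B = 1)
    (hf : IntegrableOn f S μ) (h0 : ∀ w ∈ S, 0 ≤ f w) (hc : ∀ w ∈ B, c ≤ f w) :
    c ≤ ∫ w in S, f w ∂μ := by
  calc c = ∫ _w in B, c ∂μ := by simp [Measure.real, hμ]
    _ ≤ ∫ w in B, f w ∂μ := setIntegral_mono_on (integrableOn_const (by simp [hμ]))
        (hf.mono_set hBS) hB hc
    _ ≤ ∫ w in S, f w ∂μ := setIntegral_mono_set hf
        ((ae_restrict_iff' hS).2 (Filter.Eventually.of_forall h0)) hBS.eventuallyLE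

theorem level_upper {Ω : Type*} [MeasurableSpace Ω] {μ : Measure Ω} {S : Set Ω} {F g : Ω → ℝ}
    {C : ℝ} (hS : MeasurableSet S) (hF : Measurable F) (hg : IntegrableOn g S μ)
    (hg1 : ∫ w in S, g w ∂μ = 1)
    (hg0 : ∀ w ∈ S, 0 ≤ g w) (hF0 : ∀ w ∈ S, 0 ≤ F w) (hFC : ∀ w ∈ S, F w ≤ C) :
    IntegrableOn (fun w => F w * g w) S μ ∧ 0 ≤ ∫ w in S, F w * g w ∂μ ∧
      ∫ w in S, F w * g w ∂μ ≤ C := by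
  have hi : IntegrableOn (fun w => F w * g w) S μ := by
    refine Integrable.mono' (hg.const_mul C) (hF.aestronglyMeasurable.mul hg.1) ?_
    refine (ae_restrict_iff' hS).2 (Filter.Eventually.of_forall fun w hw => ?_)
    rw [Real.norm_of_nonneg (mul_nonneg (hF0 w hw) (hg0 w hw))]
    exact mul_le_mul_of_nonneg_right (hFC w hw) (hg0 w hw)
  refine ⟨hi, setIntegral_nonneg hS fun w hw => mul_nonneg (hF0 w hw) (hg0 w hw), ?_⟩
  calc _ ≤ ∫ w in S, C * g w ∂μ := setIntegral_mono_on hi (hg.const_mul C) hS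
        fun w hw => mul_le_mul_of_nonneg_right (hFC w hw) (hg0 w hw)
    _ = C := by rw [integral_const_mul, hg1, mul_one]

section levels

variable (n p : ℕ) (X : Matrix (Fin n) (Fin p) ℝ) (y : Fin n → ℝ) (a b : ℝ) (x x' : Fin p → ℝ)

/-- integrand of the innermost integral -/
noncomputable def hsI0 (t : ℝ) (ν : Fin p → ℝ) (s : ℝ) (β : Fin p → ℝ) : ℝ :=
  (∏ j, igDens 1 ((ν j)⁻¹ + (β j) ^ 2 / (2 * s * t)) (x' j)) *
            gaussDens p (hsA n p X t x)
              ((hsA n p X t x)⁻¹.mulVec (X.transpose.mulVec y)) s β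

noncomputable def hsI1 (t : ℝ) (ν : Fin p → ℝ) (s : ℝ) : ℝ :=
  ∫ β : Fin p → ℝ, hsI0 n p X y x x' t ν s β

noncomputable def hsI2 (t : ℝ) (ν : Fin p → ℝ) : ℝ :=
  ∫ s in Set.Ioi (0 : ℝ), hsI1 n p X y x x' t ν s *
    igDens (a + (n : ℝ) / 2) (hsR n p X y b t x) s

noncomputable def hsI3 (t : ℝ) : ℝ :=
  ∫ ν in Set.univ.pi (fun _ : Fin p => Set.Ioi (0 : ℝ)), hsI2 n p X y a b x x' t ν *
    ∏ j, igDens 1 (1 + (x j)⁻¹) (ν j)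

theorem hsMTD_eq (πτ : ℝ → ℝ) : hsMTD n p X y a b πτ x x' =
    ∫ t in Set.Ioi (0 : ℝ), hsI3 n p X y a b x x' t *
      (hsTauDens n p X y a b πτ x t / ∫ u in Set.Ioi (0 : ℝ), hsTauDens n p X y a b πτ x u) := rfl

theorem meas_I0 : Measurable fun q : ((ℝ × (Fin p → ℝ)) × ℝ) × (Fin p → ℝ) =>
    hsI0 n p X y x x' q.1.1.1 q.1.1.2 q.1.2 q.2 := by
  unfold hsI0
  refine Measurable.mul (Finset.measurable_prod _ fun j _ => meas_ig ?_ measurable_const) ?_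
  · fun_prop
  · have h : Measurable fun q : ((ℝ × (Fin p → ℝ)) × ℝ) × (Fin p → ℝ) =>
      (((q.1.1.1, q.1.2), q.2) : (ℝ × ℝ) × (Fin p → ℝ)) := by fun_prop
    exact (meas_gauss X y x).comp h

theorem meas_I1 : Measurable fun q : (ℝ × (Fin p → ℝ)) × ℝ =>
    hsI1 n p X y x x' q.1.1 q.1.2 q.2 :=
  ((meas_I0 n p X y x x').stronglyMeasurable.integral_prod_right' (ν := volume)).measurable

theorem meas_I2 : Measurable fun q : ℝ × (Fin p → ℝ) => hsI2 n p X y a b x x' q.1 q.2 := by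
  have h : Measurable fun q : (ℝ × (Fin p → ℝ)) × ℝ => hsI1 n p X y x x' q.1.1 q.1.2 q.2 *
    igDens (a + (n : ℝ) / 2) (hsR n p X y b q.1.1 x) q.2 :=
    (meas_I1 n p X y x x').mul (meas_ig ((meas_hsR X y b x).comp
      (measurable_fst.comp measurable_fst)) measurable_snd)
  exact (h.stronglyMeasurable.integral_prod_right'
    (ν := volume.restrict (Set.Ioi (0 : ℝ)))).measurable

theorem meas_I3 : Measurable fun t : ℝ => hsI3 n p X y a b x x' t := by
  have h : Measurable fun q : ℝ × (Fin p → ℝ) => hsI2 n p X y a b x x' q.1 q.2 *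
      ∏ j, igDens 1 (1 + (x j)⁻¹) (q.2 j) :=
    (meas_I2 n p X y a b x x').mul (Finset.measurable_prod _ fun j _ => meas_ig measurable_const
      ((measurable_pi_apply j).comp measurable_snd))
  exact (h.stronglyMeasurable.integral_prod_right'
    (ν := volume.restrict (Set.univ.pi (fun _ : Fin p => Set.Ioi (0 : ℝ))))).measurable

theorem meas_I0_right (t : ℝ) (ν : Fin p → ℝ) (s : ℝ) :
    Measurable fun β => hsI0 n p X y x x' t ν s β := by
  have h : Measurable fun β : Fin p → ℝ => ((((t, ν), s), β) :
    ((ℝ × (Fin p → ℝ)) × ℝ) × (Fin p → ℝ)) := measurable_prodMk_left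
  have h' := (meas_I0 n p X y x x').comp h
  simpa only [Function.comp_def] using h'

theorem meas_I1_right (t : ℝ) (ν : Fin p → ℝ) :
    Measurable fun s => hsI1 n p X y x x' t ν s := by
  have h : Measurable fun s : ℝ => (((t, ν), s) : (ℝ × (Fin p → ℝ)) × ℝ) := measurable_prodMk_left
  have h' := (meas_I1 n p X y x x').comp h
  simpa only [Function.comp_def] using h'

theorem meas_I2_right (t : ℝ) : Measurable fun ν => hsI2 n p X y a b x x' t ν := by
  have h : Measurable fun ν : Fin p → ℝ => ((t, ν) : ℝ × (Fin p → ℝ)) := measurable_prodMk_left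
  have h' := (meas_I2 n p X y a b x x').comp h
  simpa only [Function.comp_def] using h'

variable {n p X y a b x x'}

theorem arg_nonneg {t s : ℝ} {ν : Fin p → ℝ} (ht : 0 < t) (hs : 0 < s) (hν : ∀ j, 0 < ν j)
    (β : Fin p → ℝ) (j : Fin p) : 0 ≤ (ν j)⁻¹ + (β j) ^ 2 / (2 * s * t) := by
  have := hν j
  positivity

theorem I0_nonneg (hx : ∀ j, 0 < x j) (hx' : ∀ j, 0 < x' j) {t s : ℝ} {ν : Fin p → ℝ} (ht : 0 < t)
    (hs : 0 < s) (hν : ∀ j, 0 < ν j) (β : Fin p → ℝ) : 0 ≤ hsI0 n p X y x x' t ν s β :=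
  mul_nonneg (Finset.prod_nonneg fun j _ => igDens_nonneg one_pos (arg_nonneg ht hs hν β j) (hx' j))
    (gaussDens_nonneg (hsA_posDef X ht hx) _ hs β)

theorem I1_level (hx : ∀ j, 0 < x j) (hx' : ∀ j, 0 < x' j) {t s : ℝ} {ν : Fin p → ℝ} (ht : 0 < t)
    (hs : 0 < s) (hν : ∀ j, 0 < ν j) :
    Integrable (hsI0 n p X y x x' t ν s) ∧ 0 ≤ hsI1 n p X y x x' t ν s ∧
      hsI1 n p X y x x' t ν s ≤ (∏ j, (x' j)⁻¹) * hsD n p X t x ^ ((1 : ℝ) / 2) := by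
  set μ := (hsA n p X t x)⁻¹ *ᵥ (Xᵀ *ᵥ y) with hμ
  have hK : 0 ≤ ∏ j, (x' j)⁻¹ := Finset.prod_nonneg fun j _ => (inv_pos.2 (hx' j)).le
  set c := (2 * Real.pi * s) ^ (-(p : ℝ) / 2) * (hsA n p X t x).det ^ ((1 : ℝ) / 2) with hc
  have hle : ∀ β, hsI0 n p X y x x' t ν s β ≤ (∏ j, (x' j)⁻¹) *
      (c * ∏ j, Real.exp (-(2 * s * (t * x j))⁻¹ * (β j - μ j) ^ 2)) := fun β =>
    mul_le_mul (Finset.prod_le_prod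
      (fun j _ => igDens_nonneg one_pos (arg_nonneg ht hs hν β j) (hx' j))
      fun j _ => igDens_one_le (hx' j)) (gaussDens_le X ht hx _ hs β)
      (gaussDens_nonneg (hsA_posDef X ht hx) _ hs β) hK
  have hbi := ((gauss_bound_integrable (fun j => (2 * s * (t * x j))⁻¹) μ
    (fun j => by have := hx j; positivity)).const_mul c).const_mul (∏ j, (x' j)⁻¹)
  have hm : Measurable fun β => hsI0 n p X y x x' t ν s β := meas_I0_right n p X y x x' t ν s
  have hi : Integrable (hsI0 n p X y x x' t ν s) := by
    refine Integrable.mono' hbi hm.aestronglyMeasurable (Filter.Eventually.of_forall fun β => ?_)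
    rw [Real.norm_of_nonneg (I0_nonneg hx hx' ht hs hν β)]
    exact hle β
  refine ⟨hi, integral_nonneg fun β => I0_nonneg hx hx' ht hs hν β, ?_⟩
  refine (integral_mono hi hbi hle).trans_eq ?_
  rw [integral_const_mul, integral_const_mul,
    gauss_bound_integral (fun j => (2 * s * (t * x j))⁻¹) μ, hc, gauss_const X ht hx hs]

theorem I2_level (ha : 0 < a) (hb : 0 < b) (hx : ∀ j, 0 < x j) (hx' : ∀ j, 0 < x' j)
    {t : ℝ} {ν : Fin p → ℝ} (ht : 0 < t) (hν : ∀ j, 0 < ν j) :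
    IntegrableOn (fun s => hsI1 n p X y x x' t ν s *
      igDens (a + (n : ℝ) / 2) (hsR n p X y b t x) s) (Set.Ioi 0) ∧
    0 ≤ hsI2 n p X y a b x x' t ν ∧
      hsI2 n p X y a b x x' t ν ≤ (∏ j, (x' j)⁻¹) * hsD n p X t x ^ ((1 : ℝ) / 2) := by
  have hα : 0 < a + (n : ℝ) / 2 := by positivity
  have hr : 0 < hsR n p X y b t x := hb.trans_le (hsR_ge X y b ht hx)
  have hm : Measurable fun s => hsI1 n p X y x x' t ν s := meas_I1_right n p X y x x' t ν
  unfold hsI2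
  exact level_upper measurableSet_Ioi hm (igDens_integrable hα hr) (igDens_integral hα hr)
    (fun s hs => igDens_nonneg hα hr.le hs) (fun s hs => (I1_level hx hx' ht hs hν).2.1)
    (fun s hs => (I1_level hx hx' ht hs hν).2.2)

theorem measSet_pi {p : ℕ} {S : Set ℝ} (hS : MeasurableSet S) :
    MeasurableSet (Set.univ.pi (fun _ : Fin p => S)) :=
  MeasurableSet.univ_pi fun _ => hS

theorem I3_level (ha : 0 < a) (hb : 0 < b) (hx : ∀ j, 0 < x j) (hx' : ∀ j, 0 < x' j)
    {t : ℝ} (ht : 0 < t) :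
    IntegrableOn (fun ν => hsI2 n p X y a b x x' t ν * ∏ j, igDens 1 (1 + (x j)⁻¹) (ν j))
      (Set.univ.pi (fun _ : Fin p => Set.Ioi (0 : ℝ))) ∧
    0 ≤ hsI3 n p X y a b x x' t ∧
      hsI3 n p X y a b x x' t ≤ (∏ j, (x' j)⁻¹) * hsD n p X t x ^ ((1 : ℝ) / 2) := by
  have hm : Measurable fun ν => hsI2 n p X y a b x x' t ν := meas_I2_right n p X y a b x x' t
  unfold hsI3
  have hc : ∀ j, 0 < 1 + (x j)⁻¹ := fun j => by have := hx j; positivity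
  have hν : ∀ ν ∈ (Set.univ.pi (fun _ : Fin p => Set.Ioi (0 : ℝ))), ∀ j, 0 < ν j :=
    fun ν h j => h j trivial
  exact level_upper (measSet_pi measurableSet_Ioi) hm
    (prod_igDens_integrable hc) (prod_igDens_integral hc)
    (fun ν h => Finset.prod_nonneg fun j _ => igDens_nonneg one_pos (hc j).le (hν ν h j))
    (fun ν h => (I2_level ha hb hx hx' ht (hν ν h)).2.1)
    (fun ν h => (I2_level ha hb hx hx' ht (hν ν h)).2.2)

/-! ### Lower bounds -/

theorem ig_x_lower {T t s ν β u : ℝ} (hT : 0 < T) (ht : T ≤ t) (hs : s ∈ Set.Icc (1 : ℝ) 2)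
    (hν : ν ∈ Set.Icc (1 : ℝ) 2) (hβ : β ^ 2 ≤ 1) (hu : 0 < u) :
    (2 * (1 + (2 * T)⁻¹))⁻¹ * igDens 1 (1 + (2 * T)⁻¹) u ≤
      igDens 1 (ν⁻¹ + β ^ 2 / (2 * s * t)) u := by
  rw [igDens_one hu, igDens_one hu]
  obtain ⟨hs1, hs2⟩ := hs
  obtain ⟨hν1, hν2⟩ := hν
  have ht0 : 0 < t := hT.trans_le ht
  have hc : 0 < 1 + (2 * T)⁻¹ := by positivity
  have h1 : (2 : ℝ)⁻¹ ≤ ν⁻¹ + β ^ 2 / (2 * s * t) := by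
    have : (2 : ℝ)⁻¹ ≤ ν⁻¹ := inv_anti₀ (by linarith) hν2
    have : 0 ≤ β ^ 2 / (2 * s * t) := by positivity
    linarith
  have h2 : ν⁻¹ + β ^ 2 / (2 * s * t) ≤ 1 + (2 * T)⁻¹ := by
    have h3 : ν⁻¹ ≤ 1 := inv_le_one_of_one_le₀ hν1
    have h4 : β ^ 2 / (2 * s * t) ≤ (2 * T)⁻¹ := by
      rw [← one_div]
      apply div_le_div₀ one_pos.le hβ (by positivity)
      nlinarith
    linarith
  calc _ = (2 : ℝ)⁻¹ * (u ^ 2)⁻¹ * Real.exp (-(1 + (2 * T)⁻¹) / u) := by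
        field_simp
    _ ≤ _ := by gcongr

theorem ig_s_lower {α b r R s : ℝ} (hα : 0 < α) (hb : 0 < b) (hr : b ≤ r) (hR : r ≤ R)
    (hs : s ∈ Set.Icc (1 : ℝ) 2) :
    b ^ α * (Real.Gamma α)⁻¹ * 2 ^ (-α - 1) * Real.exp (-R) ≤ igDens α r s := by
  obtain ⟨hs1, hs2⟩ := hs
  have hG := Real.Gamma_pos_of_pos hα
  unfold igDens
  have h1 : (2 : ℝ) ^ (-α - 1) ≤ s ^ (-α - 1) :=
    Real.rpow_le_rpow_of_nonpos (by linarith) hs2 (by linarith)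
  have h2 : Real.exp (-R) ≤ Real.exp (-r / s) := by
    rw [Real.exp_le_exp, neg_div, neg_le_neg_iff, div_le_iff₀ (by linarith)]
    nlinarith
  have h3 : 0 < r := hb.trans_le hr
  gcongr

theorem ig_nu_lower {m x ν : ℝ} (hm : 0 < m) (hx : m ≤ x) (hν : ν ∈ Set.Icc (1 : ℝ) 2) :
    (4 : ℝ)⁻¹ * Real.exp (-(1 + m⁻¹)) ≤ igDens 1 (1 + x⁻¹) ν := by
  obtain ⟨hs1, hs2⟩ := hν
  have hν0 : 0 < ν := by linarith
  have hx0 : 0 < x := hm.trans_le hx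
  rw [igDens_one hν0]
  have h0 : 0 < x⁻¹ := by positivity
  have h1 : (4 : ℝ)⁻¹ ≤ (ν ^ 2)⁻¹ := inv_anti₀ (by positivity) (by nlinarith)
  have h3 : x⁻¹ ≤ m⁻¹ := inv_anti₀ hm hx
  have h2 : Real.exp (-(1 + m⁻¹)) ≤ Real.exp (-(1 + x⁻¹) / ν) := by
    rw [Real.exp_le_exp, neg_div, neg_le_neg_iff, div_le_iff₀ (by linarith)]
    nlinarith
  have h4 : (4 : ℝ)⁻¹ ≤ (1 + x⁻¹) * (ν ^ 2)⁻¹ := by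
    have : 0 < (ν ^ 2)⁻¹ := by positivity
    nlinarith
  gcongr

theorem I1_lower {T T2 t s m M g Q : ℝ} {ν : Fin p → ℝ} (hT : 0 < T) (ht : T ≤ t) (ht2 : t ≤ T2)
    (hm : 0 < m) (hx : ∀ j, m ≤ x j) (hxM : ∀ j, x j ≤ M) (hx' : ∀ j, 0 < x' j)
    (hs : s ∈ Set.Icc (1 : ℝ) 2) (hν : ∀ j, ν j ∈ Set.Icc (1 : ℝ) 2)
    (hQ : ∀ β ∈ Set.univ.pi (fun _ : Fin p => Set.Icc (0 : ℝ) 1),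
      (X *ᵥ β - y) ⬝ᵥ (X *ᵥ β - y) ≤ Q)
    (hg : g = (2 * Real.pi * 2) ^ (-(p : ℝ) / 2) * ((T2 * M) ^ p) ^ (-((1 : ℝ) / 2)) *
      Real.exp (-(Q + p * (T * m)⁻¹))) (hg0 : 0 ≤ g) :
    ((2 * (1 + (2 * T)⁻¹))⁻¹ ^ p * ∏ j, igDens 1 (1 + (2 * T)⁻¹) (x' j)) *
      (g * hsD n p X t x ^ ((1 : ℝ) / 2)) ≤ hsI1 n p X y x x' t ν s := by
  have ht0 : 0 < t := hT.trans_le ht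
  have hx0 : ∀ j, 0 < x j := fun j => hm.trans_le (hx j)
  have hs0 : 0 < s := zero_lt_one.trans_le hs.1
  have hν0 : ∀ j, 0 < ν j := fun j => zero_lt_one.trans_le (hν j).1
  have hD : 0 < hsD n p X t x := zero_lt_one.trans_le (hsD_ge_one X ht0 hx0)
  have hc : 0 < 1 + (2 * T)⁻¹ := by positivity
  unfold hsI1
  rw [← setIntegral_univ]
  refine box_lower (B := Set.univ.pi (fun _ : Fin p => Set.Icc (0 : ℝ) 1)) MeasurableSet.univ
    (measSet_pi measurableSet_Icc) (Set.subset_univ _) ?_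
    (I1_level hx0 hx' ht0 hs0 hν0).1.integrableOn
    (fun β _ => I0_nonneg hx0 hx' ht0 hs0 hν0 β) ?_
  · rw [volume_pi_pi]; simp
  · intro β hβ
    have hβ1 : ∀ j, β j ^ 2 ≤ 1 := fun j => by
      have := hβ j trivial
      have h1 : 0 ≤ β j := this.1
      have h2 : β j ≤ 1 := this.2
      nlinarith
    refine mul_le_mul ?_ ?_ (by positivity) (Finset.prod_nonneg fun j _ =>
      igDens_nonneg one_pos (arg_nonneg ht0 hs0 hν0 β j) (hx' j))
    · calc _ = ∏ j, ((2 * (1 + (2 * T)⁻¹))⁻¹ * igDens 1 (1 + (2 * T)⁻¹) (x' j)) := by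
            rw [Finset.prod_mul_distrib]; simp
        _ ≤ _ := Finset.prod_le_prod
            (fun j _ => mul_nonneg (by positivity) (igDens_nonneg one_pos hc.le (hx' j)))
            fun j _ => ig_x_lower hT ht hs (hν j) (hβ1 j) (hx' j)
    · rw [hg]
      exact gaussDens_ge X y hT ht ht2 hm hx hxM hs.1 hs.2 β hβ1 (hQ β hβ)

theorem I3_lower {T T2 t m M g Q : ℝ} (ha : 0 < a) (hb : 0 < b)
    (hT : 0 < T) (ht : T ≤ t) (ht2 : t ≤ T2)
    (hm : 0 < m) (hx : ∀ j, m ≤ x j) (hxM : ∀ j, x j ≤ M) (hx' : ∀ j, 0 < x' j)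
    (hQ : ∀ β ∈ Set.univ.pi (fun _ : Fin p => Set.Icc (0 : ℝ) 1),
      (X *ᵥ β - y) ⬝ᵥ (X *ᵥ β - y) ≤ Q)
    (hg : g = (2 * Real.pi * 2) ^ (-(p : ℝ) / 2) * ((T2 * M) ^ p) ^ (-((1 : ℝ) / 2)) *
      Real.exp (-(Q + p * (T * m)⁻¹))) (hg0 : 0 ≤ g) :
    ((2 * (1 + (2 * T)⁻¹))⁻¹ ^ p * ∏ j, igDens 1 (1 + (2 * T)⁻¹) (x' j)) *
      (g * hsD n p X t x ^ ((1 : ℝ) / 2)) *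
      (b ^ (a + (n : ℝ) / 2) * (Real.Gamma (a + (n : ℝ) / 2))⁻¹ * 2 ^ (-(a + (n : ℝ) / 2) - 1) *
        Real.exp (-(b + y ⬝ᵥ y / 2))) *
      ((4 : ℝ)⁻¹ * Real.exp (-(1 + m⁻¹))) ^ p
      ≤ hsI3 n p X y a b x x' t := by
  have ht0 : 0 < t := hT.trans_le ht
  have hx0 : ∀ j, 0 < x j := fun j => hm.trans_le (hx j)
  have hD : 0 < hsD n p X t x := zero_lt_one.trans_le (hsD_ge_one X ht0 hx0)
  have hc : 0 < 1 + (2 * T)⁻¹ := by positivity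
  have hα : 0 < a + (n : ℝ) / 2 := by positivity
  have hG := Real.Gamma_pos_of_pos hα
  have hH : 0 ≤ ∏ j, igDens 1 (1 + (2 * T)⁻¹) (x' j) :=
    Finset.prod_nonneg fun j _ => igDens_nonneg one_pos hc.le (hx' j)
  have hrg := hsR_ge X y b ht0 hx0
  have hcx : ∀ j, 0 < 1 + (x j)⁻¹ := fun j => by have := hx0 j; positivity
  have hvol : ∀ q : ℕ, volume (Set.univ.pi (fun _ : Fin q => Set.Icc (1 : ℝ) 2)) = 1 := fun q => by
    rw [volume_pi_pi]; norm_num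
  unfold hsI3
  refine box_lower (B := Set.univ.pi (fun _ : Fin p => Set.Icc (1 : ℝ) 2))
    (measSet_pi measurableSet_Ioi) (measSet_pi measurableSet_Icc)
    (Set.pi_mono fun j _ z hz => zero_lt_one.trans_le hz.1) (hvol p)
    (I3_level ha hb hx0 hx' ht0).1 ?_ ?_
  · intro ν hν
    exact mul_nonneg (I2_level ha hb hx0 hx' ht0 (fun j => hν j trivial)).2.1
      (Finset.prod_nonneg fun j _ => igDens_nonneg one_pos (hcx j).le (hν j trivial))
  · intro ν hν
    have hν1 : ∀ j, ν j ∈ Set.Icc (1 : ℝ) 2 := fun j => hν j trivial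
    have hν0 : ∀ j, 0 < ν j := fun j => zero_lt_one.trans_le (hν1 j).1
    refine mul_le_mul ?_ ?_ (by positivity) (I2_level ha hb hx0 hx' ht0 hν0).2.1
    · unfold hsI2
      refine box_lower (B := Set.Icc (1 : ℝ) 2) measurableSet_Ioi measurableSet_Icc
        (fun z hz => zero_lt_one.trans_le hz.1) (by simp; norm_num)
        (I2_level ha hb hx0 hx' ht0 hν0).1 ?_ ?_
      · intro s hs
        exact mul_nonneg (I1_level hx0 hx' ht0 hs hν0).2.1
          (igDens_nonneg hα (hb.le.trans hrg) hs)
      · intro s hs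
        exact mul_le_mul (I1_lower hT ht ht2 hm hx hxM hx' hs hν1 hQ hg hg0)
          (ig_s_lower hα hb hrg (hsR_le X y b ht0 hx0) hs) (by positivity)
          (I1_level hx0 hx' ht0 (zero_lt_one.trans_le hs.1) hν0).2.1
    · calc _ = ∏ _j : Fin p, ((4 : ℝ)⁻¹ * Real.exp (-(1 + m⁻¹))) := by simp
        _ ≤ _ := Finset.prod_le_prod (fun j _ => by positivity)
            fun j _ => ig_nu_lower hm (hx j) (hν1 j)

end levels

/-! ### The `τ` level -/

theorem tau_le {n p : ℕ} {X : Matrix (Fin n) (Fin p) ℝ} {y : Fin n → ℝ} {a b : ℝ} {πτ : ℝ → ℝ}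
    {x : Fin p → ℝ} (ha : 0 < a) (hb : 0 < b) (hπ : ∀ t, 0 ≤ πτ t) (hx : ∀ j, 0 < x j)
    {t : ℝ} (ht : 0 < t) :
    hsD n p X t x ^ ((1 : ℝ) / 2) * hsTauDens n p X y a b πτ x t ≤
      b ^ (-(a + (n : ℝ) / 2)) * πτ t ∧
    (b + y ⬝ᵥ y / 2) ^ (-(a + (n : ℝ) / 2)) * πτ t ≤
      hsD n p X t x ^ ((1 : ℝ) / 2) * hsTauDens n p X y a b πτ x t ∧
    0 ≤ hsTauDens n p X y a b πτ x t ∧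
    hsTauDens n p X y a b πτ x t ≤ b ^ (-(a + (n : ℝ) / 2)) * πτ t := by
  have hα : 0 < a + (n : ℝ) / 2 := by positivity
  have hD1 := hsD_ge_one X ht hx
  have hD : 0 < hsD n p X t x := zero_lt_one.trans_le hD1
  have hrg := hsR_ge X y b ht hx
  have hrl := hsR_le X y b ht hx
  have hr0 : 0 < hsR n p X y b t x := hb.trans_le hrg
  have hf : hsTauDens n p X y a b πτ x t = hsR n p X y b t x ^ (-(a + (n : ℝ) / 2)) *
    hsD n p X t x ^ (-(1 / 2 : ℝ)) * πτ t := rfl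
  have h1 : hsR n p X y b t x ^ (-(a + (n : ℝ) / 2)) ≤ b ^ (-(a + (n : ℝ) / 2)) :=
    Real.rpow_le_rpow_of_nonpos hb hrg (by linarith)
  have h2 : (b + y ⬝ᵥ y / 2) ^ (-(a + (n : ℝ) / 2)) ≤ hsR n p X y b t x ^ (-(a + (n : ℝ) / 2)) :=
    Real.rpow_le_rpow_of_nonpos hr0 hrl (by linarith)
  have h3 : hsD n p X t x ^ ((1 : ℝ) / 2) * hsD n p X t x ^ (-(1 / 2 : ℝ)) = 1 := by
    rw [← Real.rpow_add hD, add_neg_cancel, Real.rpow_zero]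
  have h4 : hsD n p X t x ^ ((1 : ℝ) / 2) * hsTauDens n p X y a b πτ x t =
      hsR n p X y b t x ^ (-(a + (n : ℝ) / 2)) * πτ t := by
    rw [hf]
    linear_combination hsR n p X y b t x ^ (-(a + (n : ℝ) / 2)) * πτ t * h3
  have h0 : 0 ≤ hsTauDens n p X y a b πτ x t := by
    rw [hf]
    exact mul_nonneg (by positivity) (hπ t)
  have h5 : hsD n p X t x ^ ((1 : ℝ) / 2) * hsTauDens n p X y a b πτ x t ≤
      b ^ (-(a + (n : ℝ) / 2)) * πτ t := by
    rw [h4]; exact mul_le_mul_of_nonneg_right h1 (hπ t)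
  refine ⟨h5, ?_, h0, ?_⟩
  · rw [h4]; exact mul_le_mul_of_nonneg_right h2 (hπ t)
  · refine le_trans ?_ h5
    exact le_mul_of_one_le_left h0 (Real.one_le_rpow hD1 (by norm_num))

theorem tau_integrable {n p : ℕ} {X : Matrix (Fin n) (Fin p) ℝ} {y : Fin n → ℝ} {a b : ℝ}
    {πτ : ℝ → ℝ} {x : Fin p → ℝ} (ha : 0 < a) (hb : 0 < b) (hπ : ∀ t, 0 ≤ πτ t)
    (hπ1 : ∫ t in Set.Ioi (0 : ℝ), πτ t = 1) (hx : ∀ j, 0 < x j) :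
    IntegrableOn (hsTauDens n p X y a b πτ x) (Set.Ioi 0) ∧
    0 < ∫ t in Set.Ioi (0 : ℝ), hsTauDens n p X y a b πτ x t ∧
    ∫ t in Set.Ioi (0 : ℝ), hsTauDens n p X y a b πτ x t ≤ b ^ (-(a + (n : ℝ) / 2)) := by
  have hπi : IntegrableOn πτ (Set.Ioi 0) := integrable_of_integral_eq_one hπ1
  have hm : AEStronglyMeasurable (hsTauDens n p X y a b πτ x) (volume.restrict (Set.Ioi 0)) := by
    have h1 : Measurable fun t => hsR n p X y b t x ^ (-(a + (n : ℝ) / 2)) *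
      hsD n p X t x ^ (-(1 / 2 : ℝ)) :=
      ((meas_hsR X y b x).pow_const _).mul ((meas_hsD X x).pow_const _)
    exact h1.aestronglyMeasurable.mul hπi.1
  have hi : IntegrableOn (hsTauDens n p X y a b πτ x) (Set.Ioi 0) := by
    refine Integrable.mono' (hπi.const_mul (b ^ (-(a + (n : ℝ) / 2)))) hm ?_
    refine (ae_restrict_iff' measurableSet_Ioi).2 (Filter.Eventually.of_forall fun t ht => ?_)
    have h := tau_le (X := X) (y := y) ha hb hπ hx ht
    rw [Real.norm_of_nonneg h.2.2.1]
    exact h.2.2.2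
  have h0 : 0 ≤ ∫ t in Set.Ioi (0 : ℝ), hsTauDens n p X y a b πτ x t :=
    setIntegral_nonneg measurableSet_Ioi fun t ht =>
      (tau_le (X := X) (y := y) ha hb hπ hx ht).2.2.1
  refine ⟨hi, lt_of_le_of_ne h0 fun h => ?_, ?_⟩
  · have hae := (setIntegral_eq_zero_iff_of_nonneg_ae
      ((ae_restrict_iff' measurableSet_Ioi).2 (Filter.Eventually.of_forall fun t ht =>
        (tau_le (X := X) (y := y) ha hb hπ hx ht).2.2.1)) hi).1 h.symm
    have hz : πτ =ᵐ[volume.restrict (Set.Ioi 0)] 0 := by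
      filter_upwards [hae, self_mem_ae_restrict measurableSet_Ioi] with t h1 ht
      have h2 := (tau_le (X := X) (y := y) ha hb hπ hx ht).2.1
      rw [h1] at h2
      simp only [Pi.zero_apply, mul_zero] at h2 ⊢
      have hy := dotProduct_self_nonneg' y
      have h3 : 0 < (b + y ⬝ᵥ y / 2) ^ (-(a + (n : ℝ) / 2)) := by positivity
      exact le_antisymm (by nlinarith) (hπ t)
    rw [integral_congr_ae hz] at hπ1
    simp at hπ1
  · calc _ ≤ ∫ t in Set.Ioi (0 : ℝ), b ^ (-(a + (n : ℝ) / 2)) * πτ t :=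
          setIntegral_mono_on hi (hπi.const_mul _) measurableSet_Ioi
            fun t ht => (tau_le (X := X) (y := y) ha hb hπ hx ht).2.2.2
      _ = _ := by rw [integral_const_mul, hπ1, mul_one]

theorem outer_integrable {n p : ℕ} {X : Matrix (Fin n) (Fin p) ℝ} {y : Fin n → ℝ} {a b : ℝ}
    {πτ : ℝ → ℝ} {x x' : Fin p → ℝ} (ha : 0 < a) (hb : 0 < b) (hπ : ∀ t, 0 ≤ πτ t)
    (hπ1 : ∫ t in Set.Ioi (0 : ℝ), πτ t = 1) (hx : ∀ j, 0 < x j) (hx' : ∀ j, 0 < x' j)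
    {F : ℝ} (hF : 0 < F) :
    IntegrableOn (fun t => hsI3 n p X y a b x x' t * (hsTauDens n p X y a b πτ x t / F))
      (Set.Ioi 0) := by
  have hπi : IntegrableOn πτ (Set.Ioi 0) := integrable_of_integral_eq_one hπ1
  have hti := (tau_integrable (X := X) (y := y) ha hb hπ hπ1 hx).1
  have hK : 0 ≤ ∏ j, (x' j)⁻¹ := Finset.prod_nonneg fun j _ => (inv_pos.2 (hx' j)).le
  refine Integrable.mono'
    (hπi.const_mul ((∏ j, (x' j)⁻¹) * b ^ (-(a + (n : ℝ) / 2)) / F))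
    ((meas_I3 n p X y a b x x').aestronglyMeasurable.mul (hti.div_const F).1) ?_
  refine (ae_restrict_iff' measurableSet_Ioi).2 (Filter.Eventually.of_forall fun t ht => ?_)
  have h := tau_le (X := X) (y := y) ha hb hπ hx ht
  have h3 := I3_level (X := X) (y := y) ha hb hx hx' ht
  rw [Real.norm_of_nonneg (mul_nonneg h3.2.1 (div_nonneg h.2.2.1 hF.le))]
  calc _ ≤ ((∏ j, (x' j)⁻¹) * hsD n p X t x ^ ((1 : ℝ) / 2)) *
        (hsTauDens n p X y a b πτ x t / F) :=
        mul_le_mul_of_nonneg_right h3.2.2 (div_nonneg h.2.2.1 hF.le)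
    _ = (∏ j, (x' j)⁻¹) * (hsD n p X t x ^ ((1 : ℝ) / 2) * hsTauDens n p X y a b πτ x t) / F := by
        ring
    _ ≤ (∏ j, (x' j)⁻¹) * (b ^ (-(a + (n : ℝ) / 2)) * πτ t) / F :=
        div_le_div_of_nonneg_right (mul_le_mul_of_nonneg_left h.1 hK) hF.le
    _ = _ := by ring

theorem V_bounds {p : ℕ} {δ0 δ1 d : ℝ} (h0 : 0 < δ0) (h1 : 0 < δ1) (hd : 0 < d) {x : Fin p → ℝ}
    (hx : ∀ j, 0 < x j) (hV : ∑ j, (x j) ^ (δ0 / 2) + ∑ j, (x j) ^ (-δ1 / 2) ≤ d) (j : Fin p) :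
    d ^ (-(2 / δ1)) ≤ x j ∧ x j ≤ d ^ (2 / δ0) := by
  have a0 : ∀ j, 0 ≤ (x j) ^ (δ0 / 2) := fun j => Real.rpow_nonneg (hx j).le _
  have a1 : ∀ j, 0 ≤ (x j) ^ (-δ1 / 2) := fun j => Real.rpow_nonneg (hx j).le _
  have b0 := Finset.single_le_sum (fun j _ => a0 j) (Finset.mem_univ j)
  have b1 := Finset.single_le_sum (fun j _ => a1 j) (Finset.mem_univ j)
  have c0 := Finset.sum_nonneg (fun j (_ : j ∈ Finset.univ) => a0 j)
  have c1 := Finset.sum_nonneg (fun j (_ : j ∈ Finset.univ) => a1 j)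
  have hxj := hx j
  constructor
  · have h : (x j) ^ (-δ1 / 2) ≤ d := by linarith
    have := Real.rpow_le_rpow_of_nonpos (z := -(2 / δ1)) (by positivity) h
      (by have : 0 < 2 / δ1 := by positivity
          linarith)
    rwa [← Real.rpow_mul hxj.le, show -δ1 / 2 * -(2 / δ1) = 1 by field_simp, Real.rpow_one] at this
  · have h : (x j) ^ (δ0 / 2) ≤ d := by linarith
    have := Real.rpow_le_rpow (z := 2 / δ0) (by positivity) h (by positivity)
    rwa [← Real.rpow_mul hxj.le, show δ0 / 2 * (2 / δ0) = 1 by field_simp, Real.rpow_one] at this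

/-- (Minorization condition for the Horseshoe Gibbs
sampler.)  Suppose the prior `π_τ` vanishes on `(0,T)` for some `T > 0`.  Fix
`δ₀, δ₁ ∈ (0,1)` and `V(x) = Σⱼ x_j^{δ₀/2} + Σⱼ x_j^{−δ₁/2}`.  Then for every
`d > 0` there exist `ε* > 0` and a probability density `h` on `(0,∞)^p` such
that `k(x, x′) ≥ ε* h(x′)` for all `x′ ∈ (0,∞)^p` and all `x ∈ (0,∞)^p` with
`V(x) ≤ d`. -/
theorem stmt14 (n p : ℕ) (hn : 0 < n) (hp : 0 < p)
    (X : Matrix (Fin n) (Fin p) ℝ) (y : Fin n → ℝ)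
    (a b : ℝ) (ha : 0 < a) (hb : 0 < b)
    (πτ : ℝ → ℝ) (hπ_nonneg : ∀ t, 0 ≤ πτ t)
    (hπ_prob : ∫ t in Set.Ioi (0 : ℝ), πτ t = 1)
    (T : ℝ) (hT : 0 < T) (hvanish : ∀ t ∈ Set.Ioo (0 : ℝ) T, πτ t = 0)
    (δ0 δ1 : ℝ) (hδ0 : δ0 ∈ Set.Ioo (0 : ℝ) 1) (hδ1 : δ1 ∈ Set.Ioo (0 : ℝ) 1)
    (d : ℝ) (hd : 0 < d) :
    ∃ ε : ℝ, 0 < ε ∧ ∃ h : (Fin p → ℝ) → ℝ,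
      (∀ x', 0 ≤ h x') ∧
      (∫ x' in Set.univ.pi (fun _ : Fin p => Set.Ioi (0 : ℝ)), h x') = 1 ∧
      ∀ x x' : Fin p → ℝ, (∀ j, 0 < x j) → (∀ j, 0 < x' j) →
        (∑ j, (x j) ^ (δ0 / 2) + ∑ j, (x j) ^ (-δ1 / 2)) ≤ d →
        ε * h x' ≤ hsMTD n p X y a b πτ x x' := by
  have hπi : IntegrableOn πτ (Set.Ioi 0) := integrable_of_integral_eq_one hπ_prob
  -- choose a truncation level
  obtain ⟨T2, hT2, hmass⟩ : ∃ T2 : ℝ, 0 < T2 ∧ 0 < ∫ t in Set.Ioc 0 T2, πτ t := by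
    have h := intervalIntegral_tendsto_integral_Ioi 0 hπi Filter.tendsto_id
    rw [hπ_prob] at h
    obtain ⟨T2, h1, h2⟩ := ((h.eventually (lt_mem_nhds zero_lt_one)).and
      (Filter.eventually_gt_atTop (0 : ℝ))).exists
    refine ⟨T2, h2, ?_⟩
    rwa [id, intervalIntegral.integral_of_le (le_of_lt h2)] at h1
  -- bound of the quadratic form on the box
  obtain ⟨Q, hQ⟩ : ∃ Q : ℝ, ∀ β ∈ Set.univ.pi (fun _ : Fin p => Set.Icc (0 : ℝ) 1),
      (X *ᵥ β - y) ⬝ᵥ (X *ᵥ β - y) ≤ Q := by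
    have hcont : Continuous fun β : Fin p → ℝ => (X *ᵥ β - y) ⬝ᵥ (X *ᵥ β - y) := by fun_prop
    obtain ⟨Q, hQ⟩ := (isCompact_univ_pi fun _ : Fin p =>
      (isCompact_Icc (a := (0 : ℝ)) (b := 1))).exists_bound_of_continuousOn hcont.continuousOn
    exact ⟨Q, fun β hβ => (le_abs_self _).trans (hQ β hβ)⟩
  set m : ℝ := d ^ (-(2 / δ1)) with hm_def
  set M : ℝ := d ^ (2 / δ0) with hM_def
  have hm : 0 < m := by positivity
  have hM : 0 < M := by positivity
  have hc : 0 < 1 + (2 * T)⁻¹ := by positivity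
  have hα : 0 < a + (n : ℝ) / 2 := by positivity
  have hG := Real.Gamma_pos_of_pos hα
  have hyy := dotProduct_self_nonneg' y
  have hpi := Real.pi_pos
  obtain ⟨g, hg⟩ : ∃ g : ℝ, g = (2 * Real.pi * 2) ^ (-(p : ℝ) / 2) *
      ((T2 * M) ^ p) ^ (-((1 : ℝ) / 2)) * Real.exp (-(Q + p * (T * m)⁻¹)) := ⟨_, rfl⟩
  have hg0 : 0 < g := by rw [hg]; positivity
  obtain ⟨g2, hg2⟩ : ∃ g2 : ℝ, g2 = b ^ (a + (n : ℝ) / 2) * (Real.Gamma (a + (n : ℝ) / 2))⁻¹ *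
      2 ^ (-(a + (n : ℝ) / 2) - 1) * Real.exp (-(b + y ⬝ᵥ y / 2)) := ⟨_, rfl⟩
  have hg20 : 0 < g2 := by rw [hg2]; positivity
  obtain ⟨g3, hg3⟩ : ∃ g3 : ℝ, g3 = ((4 : ℝ)⁻¹ * Real.exp (-(1 + m⁻¹))) ^ p := ⟨_, rfl⟩
  have hg30 : 0 < g3 := by rw [hg3]; positivity
  obtain ⟨g4, hg4⟩ : ∃ g4 : ℝ, g4 = (2 * (1 + (2 * T)⁻¹))⁻¹ ^ p := ⟨_, rfl⟩
  have hg40 : 0 < g4 := by rw [hg4]; positivity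
  obtain ⟨g5, hg5⟩ : ∃ g5 : ℝ, g5 = (b + y ⬝ᵥ y / 2) ^ (-(a + (n : ℝ) / 2)) := ⟨_, rfl⟩
  have hg50 : 0 < g5 := by rw [hg5]; positivity
  have hB : 0 < b ^ (-(a + (n : ℝ) / 2)) := by positivity
  refine ⟨g4 * g * g2 * g3 * g5 / b ^ (-(a + (n : ℝ) / 2)) * ∫ t in Set.Ioc 0 T2, πτ t,
    by positivity, fun x' => |∏ j, igDens 1 (1 + (2 * T)⁻¹) (x' j)|, fun x' => abs_nonneg _, ?_, ?_⟩
  · refine Eq.trans ?_ (prod_igDens_integral (β := fun _ : Fin p => 1 + (2 * T)⁻¹) (fun _ => hc))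
    refine setIntegral_congr_fun (measSet_pi measurableSet_Ioi) fun x' hx' => ?_
    exact abs_of_nonneg (Finset.prod_nonneg fun j _ =>
      igDens_nonneg one_pos hc.le (hx' j trivial))
  intro x x' hx hx' hV
  have hxb := V_bounds hδ0.1 hδ1.1 hd hx hV
  have hH : 0 ≤ ∏ j, igDens 1 (1 + (2 * T)⁻¹) (x' j) :=
    Finset.prod_nonneg fun j _ => igDens_nonneg one_pos hc.le (hx' j)
  beta_reduce
  rw [abs_of_nonneg hH, hsMTD_eq]
  obtain ⟨-, hF0, hF1⟩ := tau_integrable (X := X) (y := y) ha hb hπ_nonneg hπ_prob hx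
  obtain ⟨F, hF⟩ : ∃ F : ℝ, F = ∫ u in Set.Ioi (0 : ℝ), hsTauDens n p X y a b πτ x u := ⟨_, rfl⟩
  rw [← hF] at hF0 hF1 ⊢
  have hint := outer_integrable (X := X) (y := y) ha hb hπ_nonneg hπ_prob hx hx' hF0
  obtain ⟨H, hHdef⟩ : ∃ H : ℝ, H = ∏ j, igDens 1 (1 + (2 * T)⁻¹) (x' j) := ⟨_, rfl⟩
  rw [← hHdef] at hH ⊢
  have hsub : Set.Ioc 0 T2 ⊆ Set.Ioi (0 : ℝ) := fun t ht => ht.1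
  have hnn : ∀ t ∈ Set.Ioi (0 : ℝ),
      0 ≤ hsI3 n p X y a b x x' t * (hsTauDens n p X y a b πτ x t / F) := fun t ht =>
    mul_nonneg (I3_level (X := X) (y := y) ha hb hx hx' ht).2.1
      (div_nonneg (tau_le (X := X) (y := y) ha hb hπ_nonneg hx ht).2.2.1 hF0.le)
  calc _ = ∫ t in Set.Ioc 0 T2, (g4 * g * g2 * g3 * g5 / b ^ (-(a + (n : ℝ) / 2)) * H) * πτ t := by
        rw [integral_const_mul]; ring
    _ ≤ ∫ t in Set.Ioc 0 T2, hsI3 n p X y a b x x' t * (hsTauDens n p X y a b πτ x t / F) := by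
        refine setIntegral_mono_on ((hπi.mono_set hsub).const_mul _) (hint.mono_set hsub)
          measurableSet_Ioc fun t ht => ?_
        rcases lt_or_ge t T with htT | htT
        · rw [hvanish t ⟨ht.1, htT⟩, mul_zero]
          exact hnn t ht.1
        have h3 := I3_lower (X := X) (y := y) ha hb hT htT ht.2 hm (fun j => (hxb j).1)
          (fun j => (hxb j).2) hx' hQ hg hg0.le
        rw [← hg2, ← hg3, ← hg4, ← hHdef] at h3
        have ht1 := tau_le (X := X) (y := y) ha hb hπ_nonneg hx ht.1
        rw [← hg5] at ht1
        have hπt := hπ_nonneg t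
        calc _ = g4 * g * g2 * g3 * H * (g5 * πτ t) / b ^ (-(a + (n : ℝ) / 2)) := by ring
          _ ≤ g4 * g * g2 * g3 * H * (g5 * πτ t) / F := by gcongr
          _ ≤ g4 * g * g2 * g3 * H *
              (hsD n p X t x ^ ((1 : ℝ) / 2) * hsTauDens n p X y a b πτ x t) / F :=
              div_le_div_of_nonneg_right
                (mul_le_mul_of_nonneg_left ht1.2.1 (by positivity)) hF0.le
          _ = g4 * H * (g * hsD n p X t x ^ ((1 : ℝ) / 2)) * g2 * g3 *
              (hsTauDens n p X y a b πτ x t / F) := by ring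
          _ ≤ _ := mul_le_mul_of_nonneg_right h3 (div_nonneg ht1.2.2.1 hF0.le)
    _ ≤ _ := setIntegral_mono_set hint
        ((ae_restrict_iff' measurableSet_Ioi).2 (Filter.Eventually.of_forall hnn)) hsub.eventuallyLE
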